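/- arXiv:1609.02532 — 2 statements merged into one kernel-verified Lean document; each statement's English description precedes it below -/
import Mathlib

section
/- Let m > 0, n > 0 be real numbers, p ∈ (0,1), and d ≥ 1 a natural number. Let n_1, …, n_d be real numbers with 0 < n_x ≤ n for every x and n_x < n for at least one x. Define k = -(m/n)·ln p, per-level memory m_x = (m/d)·(n_x/n), and per-level hash count k_x = -(m_x/n_x)·ln p. Then (i) k_x = k/d for every x, (ii) the per-level false positive probability (1-p)^{k_x} equals (1-p)^{k/d} for every x, (iii) the overall false positive probability ∏_{x=1}^{d} (1-p)^{k_x} equals (1-p)^{k}, the false positive probability of the Standard Bloom filter, and (iv) ∑_{x=1}^{d} m_x < m. That is, an I(FIB)F following Strategy I saves memory positions while the overall probability of false positives remains the same. -/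
/-- Strategy I: splitting a Standard Bloom filter (m positions, n elements,
bit-zero probability p, k = -(m/n)·ln p hashes) into d iterated levels with
per-level memory m_x = (m/d)·(n_x/n) and per-level hash count
k_x = -(m_x/n_x)·ln p gives (i) k_x = k/d, (ii) per-level false positive
probability (1-p)^{k_x} = (1-p)^{k/d}, (iii) overall false positive
probability ∏_x (1-p)^{k_x} = (1-p)^k, and (iv) total memory ∑_x m_x < m. -/
theorem strategyI_saves_memory_keeps_fpp
    (m n p : ℝ) (d : ℕ) (hm : 0 < m) (hn : 0 < n)
    (hp : p ∈ Set.Ioo (0 : ℝ) 1) (hd : 1 ≤ d)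
    (nx : Fin d → ℝ)
    (hnx_pos : ∀ x, 0 < nx x) (hnx_le : ∀ x, nx x ≤ n)
    (hnx_lt : ∃ x, nx x < n)
    (k : ℝ) (hk : k = -(m / n) * Real.log p)
    (mx kx : Fin d → ℝ)
    (hmx : ∀ x, mx x = (m / d) * (nx x / n))
    (hkx : ∀ x, kx x = -(mx x / nx x) * Real.log p) :
    (∀ x, kx x = k / d) ∧
    (∀ x, (1 - p) ^ (kx x) = (1 - p) ^ (k / d)) ∧
    (∏ x : Fin d, (1 - p) ^ (kx x) = (1 - p) ^ k) ∧
    (∑ x : Fin d, mx x < m) := by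
  have hd0 : (0 : ℝ) < d := by exact_mod_cast hd
  have hk_level : ∀ x, kx x = k / d := by
    intro x
    have hx := (hnx_pos x).ne'
    rw [hkx, hmx, hk]
    field_simp
  refine ⟨hk_level, fun x => by rw [hk_level x], ?_, ?_⟩
  · simp only [hk_level]
    rw [Finset.prod_const, Finset.card_univ, Fintype.card_fin, ← Real.rpow_natCast,
      ← Real.rpow_mul (sub_nonneg.2 hp.2.le), div_mul_cancel₀ _ hd0.ne']
  · have hmd : 0 < m / d := div_pos hm hd0
    calc ∑ x, mx x < ∑ _x : Fin d, m / d := by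
          refine Finset.sum_lt_sum (fun x _ => ?_) ?_
          · rw [hmx]
            exact mul_le_of_le_one_right hmd.le ((div_le_one hn).2 (hnx_le x))
          · obtain ⟨x, hx⟩ := hnx_lt
            refine ⟨x, Finset.mem_univ x, ?_⟩
            rw [hmx]
            exact mul_lt_of_lt_one_right hmd ((div_lt_one hn).2 hx)
      _ = m := by
          rw [Finset.sum_const, Finset.card_univ, Fintype.card_fin, nsmul_eq_mul,
            mul_div_cancel₀ _ hd0.ne']
end

section
/- Let m > 0, n > 0 be real numbers, p ∈ (0,1), and d ≥ 1 a natural number. Let n_1, …, n_d be real numbers with 0 < n_x ≤ n for every x and n_x < n for at least one x. Define k = -(m/n)·ln p, fix the per-level memory m_x = m/d, and define the per-level hash count k'_x = -((m/d)/n_x)·ln p. Then (i) k'_x ≥ k/d for every x with strict inequality for at least one x, and (ii) the overall false positive probability satisfies ∏_{x=1}^{d} (1-p)^{k'_x} < (1-p)^{k}. That is, an I(FIB)F following Strategy II reduces the overall probability of false positives while the overall memory positions remain the same (∑_x m_x = m). -/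
/-- Strategy II: fixing the per-level memory m_x = m/d of a Standard Bloom
filter (m positions, n elements, bit-zero probability p, k = -(m/n)·ln p
hashes) and using per-level hash counts k'_x = -((m/d)/n_x)·ln p with
n_x ≤ n (strict at some level) gives (i) k'_x ≥ k/d for every x with strict
inequality at some x, (ii) overall false positive probability
∏_x (1-p)^{k'_x} < (1-p)^k, while (iii) the total memory is unchanged:
∑_x m/d = m. -/
theorem strategyII_reduces_fpp_keeps_memory
    (m n p : ℝ) (d : ℕ) (hm : 0 < m) (hn : 0 < n)
    (hp : p ∈ Set.Ioo (0 : ℝ) 1) (hd : 1 ≤ d)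
    (nx : Fin d → ℝ)
    (hnx_pos : ∀ x, 0 < nx x) (hnx_le : ∀ x, nx x ≤ n)
    (hnx_lt : ∃ x, nx x < n)
    (k : ℝ) (hk : k = -(m / n) * Real.log p)
    (kx' : Fin d → ℝ)
    (hkx' : ∀ x, kx' x = -((m / d) / nx x) * Real.log p) :
    ((∀ x, k / d ≤ kx' x) ∧ (∃ x, k / d < kx' x)) ∧
    (∏ x : Fin d, (1 - p) ^ (kx' x) < (1 - p) ^ k) ∧
    (∑ _x : Fin d, m / d = m) := by
  obtain ⟨hp0, hp1⟩ := hp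
  have hd0 : (0 : ℝ) < d := by exact_mod_cast hd
  have hlog : 0 < -Real.log p := neg_pos.mpr (Real.log_neg hp0 hp1)
  have hk_div : k / d = m / d / n * -Real.log p := by
    rw [hk]
    field_simp
  have hkx_eq : ∀ x, kx' x = m / d / nx x * -Real.log p := fun x => by
    rw [hkx' x]
    ring
  have hle : ∀ x, k / d ≤ kx' x := fun x => by
    rw [hk_div, hkx_eq x]
    exact mul_le_mul_of_nonneg_right
      (div_le_div_of_nonneg_left (by positivity) (hnx_pos x) (hnx_le x)) hlog.le
  have hlt : ∃ x, k / d < kx' x := by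
    obtain ⟨x, hx⟩ := hnx_lt
    refine ⟨x, ?_⟩
    rw [hk_div, hkx_eq x]
    exact mul_lt_mul_of_pos_right
      (div_lt_div_of_pos_left (by positivity) (hnx_pos x) hx) hlog
  have hsum_const : ∀ a : ℝ, ∑ _x : Fin d, a / d = a := fun a => by
    rw [Finset.sum_const, Finset.card_univ, Fintype.card_fin, nsmul_eq_mul]
    field_simp
  refine ⟨⟨hle, hlt⟩, ?_, hsum_const m⟩
  rw [← Real.rpow_sum_of_pos (sub_pos.mpr hp1)]
  refine Real.rpow_lt_rpow_of_exponent_gt (sub_pos.mpr hp1) (by linarith) ?_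
  calc k = ∑ _x : Fin d, k / d := (hsum_const k).symm
    _ < ∑ x, kx' x := Finset.sum_lt_sum (fun x _ => hle x)
        (hlt.imp fun x hx => ⟨Finset.mem_univ x, hx⟩)
end
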